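/- Consider ADMM for the unconstrained lifted ℓ1 problem with U = [0,∞)^n, ψ(y) = (γ/2)‖A y - b‖_2², C_A := ‖AᵀA‖_2, ρ ≥ √2 · γ C_A, and g a Type C function that is continuously differentiable on U. Suppose the sequence (u^k, x^k, y^k, v^k) is generated by the ADMM iterations and (u^k, x^k) is bounded. Then (y^k, v^k) is also bounded, and every limit point (u*, x*, y*, v*) of the sequence satisfies: x* = y*, v* = ∇ψ(y*) = γ Aᵀ(A y* - b), and there exist s* ∈ ℝ^n with s* ≥ 0 and s* ⊙ u* = 0, and p* ∈ ℝ^n with p*_i ∈ [-1,1] for all i and p*_i = sign(x*_i) whenever x*_i ≠ 0, such that 0 = |x*| + α ∇g(u*) - s* and 0 = u* ⊙ p* + ∇ψ(x*). In particular (x*, u*) is a stationary point of the unconstrained problem min_{x, u ≥ 0} ⟨u, |x|⟩ + α g(u) + (γ/2)‖A x - b‖_2². -/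

import Mathlib

/-- The Euclidean (ℓ2) norm of a vector. -/
noncomputable def l2norm {k : ℕ} (z : Fin k → ℝ) : ℝ :=
  Real.sqrt (∑ i, z i ^ 2)

/-- The squared Euclidean (ℓ2) norm of a vector. -/
noncomputable def l2sq {k : ℕ} (z : Fin k → ℝ) : ℝ := ∑ i, z i ^ 2

/-- The spectral (ℓ2 operator) norm of a square matrix. -/
noncomputable def specNorm {k : ℕ} (M : Matrix (Fin k) (Fin k) ℝ) : ℝ :=
  sSup {c : ℝ | ∃ y : Fin k → ℝ, l2norm y = 1 ∧ c = l2norm (M.mulVec y)}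

/-- The augmented Lagrangian
`L_ρ(u, x, y; v) = ⟨u, |x|⟩ + α g(u) + (γ/2)‖Ay - b‖² + ⟨v, x - y⟩ + (ρ/2)‖x - y‖²`
(with the indicator `δ_U(u)` omitted; it vanishes at all iterates since `u^k ∈ U`). -/
noncomputable def augLag {m n : ℕ} (A : Matrix (Fin m) (Fin n) ℝ) (b : Fin m → ℝ)
    (g : (Fin n → ℝ) → ℝ) (α γ ρ : ℝ) (u x y v : Fin n → ℝ) : ℝ :=
  (∑ i, u i * |x i|) + α * g u + γ / 2 * l2sq (A.mulVec y - b) +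
    (∑ i, v i * (x i - y i)) + ρ / 2 * l2sq (x - y)

open Matrix Filter Set in
theorem l2sq_dot {k : ℕ} (z : Fin k → ℝ) : l2sq z = z ⬝ᵥ z := by
  simp [l2sq, dotProduct, sq]

theorem l2sq_nonneg {k : ℕ} (z : Fin k → ℝ) : 0 ≤ l2sq z :=
  Finset.sum_nonneg fun _ _ => sq_nonneg _

theorem l2norm_nonneg {k : ℕ} (z : Fin k → ℝ) : 0 ≤ l2norm z := Real.sqrt_nonneg _

theorem l2norm_sq {k : ℕ} (z : Fin k → ℝ) : l2norm z ^ 2 = l2sq z :=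
  Real.sq_sqrt (l2sq_nonneg z)

theorem l2sq_smul {k : ℕ} (t : ℝ) (z : Fin k → ℝ) : l2sq (t • z) = t ^ 2 * l2sq z := by
  simp [l2sq, mul_pow, Finset.mul_sum]

theorem l2norm_smul {k : ℕ} (t : ℝ) (z : Fin k → ℝ) : l2norm (t • z) = |t| * l2norm z := by
  have h := l2sq_smul t z
  unfold l2norm
  unfold l2sq at h
  rw [h, Real.sqrt_mul (sq_nonneg t), Real.sqrt_sq_eq_abs]

theorem coord_sq_le {k : ℕ} (z : Fin k → ℝ) (i : Fin k) : z i ^ 2 ≤ l2sq z :=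
  Finset.single_le_sum (f := fun i => z i ^ 2) (fun _ _ => sq_nonneg _) (Finset.mem_univ i)

theorem mulVec_bound {m n : ℕ} (M : Matrix (Fin m) (Fin n) ℝ) :
    ∃ K : ℝ, 0 < K ∧ ∀ z, l2sq (M.mulVec z) ≤ K * l2sq z := by
  refine ⟨(∑ i, ∑ j, M i j ^ 2) + 1, by positivity, fun z => ?_⟩
  have h : l2sq (M.mulVec z) ≤ (∑ i, ∑ j, M i j ^ 2) * l2sq z := by
    rw [Finset.sum_mul]
    apply Finset.sum_le_sum
    intro i _
    exact Finset.sum_mul_sq_le_sq_mul_sq (R := ℝ) Finset.univ (M i) z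
  nlinarith [l2sq_nonneg z]

theorem specNorm_bound {n : ℕ} (M : Matrix (Fin n) (Fin n) ℝ) (z : Fin n → ℝ) :
    l2norm (M.mulVec z) ≤ specNorm M * l2norm z := by
  obtain ⟨K, hK, hb⟩ := mulVec_bound M
  have hbdd : BddAbove {c : ℝ | ∃ y : Fin n → ℝ, l2norm y = 1 ∧ c = l2norm (M.mulVec y)} := by
    refine ⟨Real.sqrt K, ?_⟩
    rintro _ ⟨y, hy, rfl⟩
    apply Real.sqrt_le_sqrt
    have := hb y
    rw [← l2norm_sq y, hy] at this
    simpa [l2sq] using this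
  rcases (l2norm_nonneg z).eq_or_lt with h0 | h0
  · have h1 := hb z
    rw [← l2norm_sq z, ← l2norm_sq, ← h0] at h1
    rw [← h0]
    have h2 : l2norm (M.mulVec z) ^ 2 = 0 := le_antisymm (by simpa using h1) (sq_nonneg _)
    have h3 : l2norm (M.mulVec z) = 0 := by simpa using h2
    rw [h3]; simp
  · have h1 : l2norm (M.mulVec ((l2norm z)⁻¹ • z)) ≤ specNorm M := by
      apply le_csSup hbdd
      refine ⟨_, ?_, rfl⟩
      rw [l2norm_smul, abs_of_pos (by positivity)]
      field_simp
    rw [Matrix.mulVec_smul, l2norm_smul, abs_of_pos (by positivity)] at h1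
    rw [inv_mul_le_iff₀ h0] at h1
    linarith

theorem specNorm_nonneg {n : ℕ} (M : Matrix (Fin n) (Fin n) ℝ) : 0 ≤ specNorm M := by
  apply Real.sSup_nonneg
  rintro _ ⟨y, hy, rfl⟩
  exact l2norm_nonneg _

open Matrix in
theorem aug_y_expand {m n : ℕ} (A : Matrix (Fin m) (Fin n) ℝ) (b : Fin m → ℝ)
    (g : (Fin n → ℝ) → ℝ) (α γ ρ : ℝ) (u x y v d : Fin n → ℝ) :
    augLag A b g α γ ρ u x (y + d) v = augLag A b g α γ ρ u x y v
      + (γ • Aᵀ.mulVec (A.mulVec y - b) - v - ρ • (x - y)) ⬝ᵥ d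
      + (γ / 2 * l2sq (A.mulVec d) + ρ / 2 * l2sq d) := by
  have e1 : A.mulVec (y + d) - b = (A.mulVec y - b) + A.mulVec d := by
    rw [Matrix.mulVec_add]; abel
  have e2 : x - (y + d) = (x - y) - d := by abel
  have e3 : Aᵀ.mulVec (A.mulVec y - b) ⬝ᵥ d = (A.mulVec y - b) ⬝ᵥ A.mulVec d := by
    rw [dotProduct_mulVec, ← mulVec_transpose]
  have e4 : ∀ z : Fin n → ℝ, ∑ i, v i * (x i - z i) = v ⬝ᵥ (x - z) := fun z => rfl
  unfold augLag
  rw [e4, e4, e1, e2]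
  rw [sub_dotProduct, sub_dotProduct, smul_dotProduct, smul_dotProduct, smul_eq_mul,
    smul_eq_mul, e3]
  simp only [l2sq_dot]
  generalize A.mulVec y - b = r
  generalize A.mulVec d = e
  generalize x - y = w
  simp only [add_dotProduct, dotProduct_add, sub_dotProduct, dotProduct_sub]
  rw [dotProduct_comm e r, dotProduct_comm d w]
  ring

open Matrix in
theorem aug_y_opt {m n : ℕ} (A : Matrix (Fin m) (Fin n) ℝ) (b : Fin m → ℝ)
    (g : (Fin n → ℝ) → ℝ) (α γ ρ : ℝ) (u x y v : Fin n → ℝ)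
    (h : ∀ z, augLag A b g α γ ρ u x y v ≤ augLag A b g α γ ρ u x z v) :
    γ • Aᵀ.mulVec (A.mulVec y - b) - v - ρ • (x - y) = 0 := by
  set G := γ • Aᵀ.mulVec (A.mulVec y - b) - v - ρ • (x - y) with hG
  set Q := γ / 2 * l2sq (A.mulVec G) + ρ / 2 * l2sq G with hQ
  have key : ∀ t : ℝ, 0 ≤ t * (G ⬝ᵥ G) + t ^ 2 * Q := by
    intro t
    have h1 := h (y + t • G)
    rw [aug_y_expand, ← hG, Matrix.mulVec_smul, l2sq_smul, l2sq_smul, dotProduct_smul,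
      smul_eq_mul] at h1
    rw [hQ]; linarith
  have hnn : 0 ≤ G ⬝ᵥ G := by rw [← l2sq_dot]; exact l2sq_nonneg _
  have : G ⬝ᵥ G = 0 := by
    by_contra hne
    have hpos : 0 < G ⬝ᵥ G := lt_of_le_of_ne hnn (Ne.symm hne)
    set S := G ⬝ᵥ G
    have hk := key (-(S / (2 * (|Q| + S))))
    have hq : Q ≤ |Q| := le_abs_self _
    have hq0 : 0 ≤ |Q| := abs_nonneg _
    have hden : 0 < 2 * (|Q| + S) := by positivity
    set t := S / (2 * (|Q| + S)) with ht
    have htpos : 0 < t := by positivity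
    have htS : t * (2 * (|Q| + S)) = S := by rw [ht]; field_simp
    have h2 : 0 ≤ t * (t * Q - S) := by nlinarith
    have h3 : 0 ≤ t * Q - S := nonneg_of_mul_nonneg_right h2 htpos
    nlinarith
  exact dotProduct_self_eq_zero.mp this

theorem sum_min_coord {n : ℕ} (f : Fin n → ℝ → ℝ) (S : Set ℝ) (X : Fin n → ℝ)
    (hX : ∀ i, X i ∈ S)
    (h : ∀ z : Fin n → ℝ, (∀ i, z i ∈ S) → ∑ i, f i (X i) ≤ ∑ i, f i (z i))
    (i : Fin n) (t : ℝ) (ht : t ∈ S) : f i (X i) ≤ f i t := by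
  have h1 := h (Function.update X i t) (by
    intro j
    by_cases hj : j = i
    · subst hj; simpa using ht
    · simpa [Function.update_of_ne hj] using hX j)
  rw [← Finset.add_sum_erase _ _ (Finset.mem_univ i),
    ← Finset.add_sum_erase _ _ (Finset.mem_univ i)] at h1
  have h2 : ∑ j ∈ Finset.univ.erase i, f j (Function.update X i t j)
      = ∑ j ∈ Finset.univ.erase i, f j (X j) := by
    apply Finset.sum_congr rfl
    intro j hj
    rw [Function.update_of_ne (Finset.ne_of_mem_erase hj)]
  rw [h2, Function.update_self] at h1
  linarith

/-- scalar x-step objective -/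
noncomputable def qx (ρ u v y s : ℝ) : ℝ := u * |s| + v * (s - y) + ρ / 2 * (s - y) ^ 2

theorem aug_x_sum {m n : ℕ} (A : Matrix (Fin m) (Fin n) ℝ) (b : Fin m → ℝ)
    (g : (Fin n → ℝ) → ℝ) (α γ ρ : ℝ) (u x y v : Fin n → ℝ) :
    augLag A b g α γ ρ u x y v =
      (α * g u + γ / 2 * l2sq (A.mulVec y - b)) + ∑ i, qx ρ (u i) (v i) (y i) (x i) := by
  simp only [augLag, qx, Finset.sum_add_distrib, ← Finset.mul_sum]
  simp only [l2sq, Pi.sub_apply]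
  ring

theorem qx_strong (ρ u v y s' s : ℝ) (hu : 0 ≤ u) 
    (h : ∀ t, qx ρ u v y s' ≤ qx ρ u v y t) :
    qx ρ u v y s' + ρ / 2 * (s - s') ^ 2 ≤ qx ρ u v y s := by
  have key : ∀ t : ℝ, 0 < t → t < 1 →
      qx ρ u v y s' + ρ / 2 * (1 - t) * (s - s') ^ 2 ≤ qx ρ u v y s := by
    intro t h0 h1
    have h2 := h ((1 - t) * s' + t * s)
    have h3 : |(1 - t) * s' + t * s| ≤ (1 - t) * |s'| + t * |s| := by
      refine (abs_add_le _ _).trans ?_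
      rw [abs_mul, abs_mul, abs_of_pos h0, abs_of_pos (by linarith : 0 < 1 - t)]
    have h4 := mul_le_mul_of_nonneg_left h3 hu
    unfold qx at *
    have h5 : 0 ≤ t * ((u * |s| + v * (s - y) + ρ / 2 * (s - y) ^ 2) -
      (u * |s'| + v * (s' - y) + ρ / 2 * (s' - y) ^ 2 + ρ / 2 * (1 - t) * (s - s') ^ 2)) := by
      nlinarith
    linarith [nonneg_of_mul_nonneg_right h5 h0]
  have hc : Filter.Tendsto (fun t : ℝ => qx ρ u v y s' + ρ / 2 * (1 - t) * (s - s') ^ 2)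
      (nhdsWithin 0 (Set.Ioi 0)) (nhds (qx ρ u v y s' + ρ / 2 * (1 - 0) * (s - s') ^ 2)) := by
    apply Filter.Tendsto.mono_left _ nhdsWithin_le_nhds
    exact (by fun_prop : Continuous fun t : ℝ =>
      qx ρ u v y s' + ρ / 2 * (1 - t) * (s - s') ^ 2).tendsto 0
  have h6 := le_of_tendsto hc (b := qx ρ u v y s) (by
    filter_upwards [Ioo_mem_nhdsGT (zero_lt_one' ℝ)] with t ht
    exact key t ht.1 ht.2)
  simpa using h6

theorem u_stat (f : ℝ → ℝ) (hf : ContDiffOn ℝ 1 f (Set.Ici 0)) (X α u : ℝ) (hu : 0 ≤ u)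
    (h : ∀ t, 0 ≤ t → u * X + α * f u ≤ t * X + α * f t) :
    0 ≤ X + α * derivWithin f (Set.Ici 0) u ∧
      (X + α * derivWithin f (Set.Ici 0) u) * u = 0 := by
  have hd : HasDerivWithinAt f (derivWithin f (Set.Ici 0) u) (Set.Ici 0) u :=
    ((hf.differentiableOn one_ne_zero) u hu).hasDerivWithinAt
  set f' := derivWithin f (Set.Ici 0) u
  have hF : HasDerivWithinAt (fun t => t * X + α * f t) (X + α * f') (Set.Ici 0) u := by
    have := ((hasDerivWithinAt_id u (Set.Ici 0)).mul_const X).add (hd.const_mul α)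
    rw [one_mul] at this
    exact this
  have hmin : IsMinOn (fun t => t * X + α * f t) (Set.Ici 0) u := fun t ht => h t ht
  have hnn : ∀ w, 0 ≤ w → 0 ≤ (X + α * f') * (w - u) := by
    intro w hw
    have := hmin.localize.hasFDerivWithinAt_nonneg hF.hasFDerivWithinAt
      (y := w - u) (mem_posTangentConeAt_of_segment_subset
        ((convex_Ici (0:ℝ)).segment_subset hu (by simpa using hw)))
    simpa [mul_comm] using this
  have h1 := hnn (u + 1) (by linarith)
  have h2 := hnn 0 le_rfl
  have h1' : 0 ≤ X + α * f' := by simpa using h1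
  refine ⟨h1', ?_⟩
  nlinarith [mul_nonneg h1' hu]

theorem x_stat (ρ u v s : ℝ) (hu : 0 ≤ u) 
    (h : ∀ t, qx ρ u v s s ≤ qx ρ u v s t) :
    ∃ p : ℝ, p ∈ Set.Icc (-1 : ℝ) 1 ∧ (s ≠ 0 → p = Real.sign s) ∧ 0 = u * p + v := by
  by_cases hs : s = 0
  · subst hs
    have key : ∀ t, 0 ≤ u * |t| + v * t + ρ / 2 * t ^ 2 := by
      intro t; simpa [qx] using h t
    have lim : ∀ e : ℝ, |e| = 1 → 0 ≤ u + v * e := by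
      intro e he
      have hk : ∀ t : ℝ, 0 < t → 0 ≤ u + v * e + ρ / 2 * t := by
        intro t ht
        have h1 := key (t * e)
        have he2 : e ^ 2 = 1 := by rw [← sq_abs, he]; norm_num
        rw [abs_mul, he, abs_of_pos ht, mul_pow, he2] at h1
        have : 0 ≤ t * (u + v * e + ρ / 2 * t) := by nlinarith
        exact nonneg_of_mul_nonneg_right this ht
      have hc : Filter.Tendsto (fun t : ℝ => u + v * e + ρ / 2 * t)
          (nhdsWithin 0 (Set.Ioi 0)) (nhds (u + v * e + ρ / 2 * 0)) := by
        apply Filter.Tendsto.mono_left _ nhdsWithin_le_nhds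
        exact (by fun_prop : Continuous fun t : ℝ => u + v * e + ρ / 2 * t).tendsto 0
      have := ge_of_tendsto hc (b := 0) (by
        filter_upwards [self_mem_nhdsWithin] with t ht using hk t ht)
      simpa using this
    have h1 := lim 1 (by simp)
    have h2 := lim (-1) (by simp)
    rcases hu.eq_or_lt with h0 | h0
    · refine ⟨0, by simp, by simp, ?_⟩
      rw [← h0] at h1 h2 ⊢
      linarith
    · refine ⟨-v / u, ⟨?_, ?_⟩, by simp, ?_⟩
      · rw [le_div_iff₀ h0]; linarith
      · rw [div_le_iff₀ h0]; linarith
      · field_simp; ring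
  · refine ⟨Real.sign s, ?_, fun _ => rfl, ?_⟩
    · rcases lt_or_gt_of_ne hs with h' | h'
      · rw [Real.sign_of_neg h']; simp
      · rw [Real.sign_of_pos h']; simp
    · have hmin : IsLocalMin (fun t => qx ρ u v s t) s := Filter.Eventually.of_forall h
      have habs : HasDerivAt (fun t : ℝ => |t|) (Real.sign s) s := by
        rcases lt_or_gt_of_ne hs with h' | h'
        · rw [Real.sign_of_neg h']; exact hasDerivAt_abs_neg h'
        · rw [Real.sign_of_pos h']; exact hasDerivAt_abs_pos h'
      have hid := (hasDerivAt_id s).sub_const s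
      have hd : HasDerivAt (fun t => qx ρ u v s t) (u * Real.sign s + v) s := by
        have := ((habs.const_mul u).add (hid.const_mul v)).add ((hid.pow 2).const_mul (ρ / 2))
        have e : u * Real.sign s + v = u * Real.sign s + v * 1 +
            ρ / 2 * (((2 : ℕ) : ℝ) * (id s - s) ^ (2 - 1) * 1) := by simp
        rw [e]
        exact this
      exact (hmin.hasDerivAt_eq_zero hd).symm

theorem l2sq_sub_le {k : ℕ} (p q : Fin k → ℝ) : l2sq (p - q) ≤ 2 * l2sq p + 2 * l2sq q := by
  simp only [l2sq, Finset.mul_sum, ← Finset.sum_add_distrib, Pi.sub_apply]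
  apply Finset.sum_le_sum
  intro i _
  nlinarith [sq_nonneg (p i + q i)]

open Matrix in
theorem dot_le {k : ℕ} (p q : Fin k → ℝ) : 2 * (p ⬝ᵥ q) ≤ l2sq p + l2sq q := by
  simp only [l2sq, dotProduct, Finset.mul_sum, ← Finset.sum_add_distrib]
  apply Finset.sum_le_sum
  intro i _
  nlinarith [sq_nonneg (p i - q i)]

theorem l2sq_neg {k : ℕ} (p : Fin k → ℝ) : l2sq (-p) = l2sq p := by
  simp [l2sq]

open Matrix in
theorem y_step {m n : ℕ} (A : Matrix (Fin m) (Fin n) ℝ) (b : Fin m → ℝ) (γ ρ : ℝ)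
    (hγ : 0 < γ) (hρ : 0 < ρ) (y y' x' : Fin n → ℝ)
    (h : γ • Aᵀ.mulVec (A.mulVec y' - b) = γ • Aᵀ.mulVec (A.mulVec y - b) + ρ • (x' - y')) :
    γ * l2sq (A.mulVec y') + ρ * l2sq y' ≤ γ * l2sq (A.mulVec y) + ρ * l2sq x' := by
  have h1 := congrArg (fun z => z ⬝ᵥ y') h
  have e3 : ∀ r, Aᵀ.mulVec r ⬝ᵥ y' = r ⬝ᵥ A.mulVec y' := by
    intro r
    rw [dotProduct_mulVec, ← mulVec_transpose]
  simp only [add_dotProduct, smul_dotProduct, smul_eq_mul, e3, sub_dotProduct, ← l2sq_dot] at h1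
  have h2 := mul_le_mul_of_nonneg_left (dot_le (A.mulVec y) (A.mulVec y')) hγ.le
  have h3 := mul_le_mul_of_nonneg_left (dot_le x' y') hρ.le
  linarith

theorem bdd_shift (f : ℕ → ℝ) (B : ℝ) (h : ∀ k, f (k + 1) ≤ B) : ∃ B', ∀ k, f k ≤ B' := by
  refine ⟨max B (f 0), fun k => ?_⟩
  cases k with
  | zero => exact le_max_right _ _
  | succ k => exact (h k).trans (le_max_left _ _)

theorem tendsto_of_l2sq {k : ℕ} (z : ℕ → Fin k → ℝ)
    (h : Filter.Tendsto (fun j => l2sq (z j)) Filter.atTop (nhds 0)) :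
    Filter.Tendsto z Filter.atTop (nhds 0) := by
  rw [tendsto_pi_nhds]
  intro i
  have h1 : Filter.Tendsto (fun j => (z j i) ^ 2) Filter.atTop (nhds 0) :=
    squeeze_zero (fun j => sq_nonneg _) (fun j => coord_sq_le (z j) i) h
  have h2 := (Real.continuous_sqrt.tendsto 0).comp h1
  simp only [Function.comp_def, Real.sqrt_sq_eq_abs, Real.sqrt_zero] at h2
  exact (tendsto_zero_iff_abs_tendsto_zero _).mpr h2

theorem tendsto_descent (L D : ℕ → ℝ) (hD : ∀ k, 0 ≤ D k) (h : ∀ k, L (k + 1) + D k ≤ L k)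
    (B : ℝ) (hB : ∀ k, B ≤ L k) : Filter.Tendsto D Filter.atTop (nhds 0) := by
  have hanti : Antitone L := antitone_nat_of_succ_le fun k => by linarith [hD k, h k]
  have hl := tendsto_atTop_ciInf hanti ⟨B, by rintro _ ⟨k, rfl⟩; exact hB k⟩
  have hl' := (Filter.tendsto_add_atTop_iff_nat 1).mpr hl
  have := hl.sub hl'
  rw [sub_self] at this
  exact squeeze_zero hD (fun k => by linarith [h k]) this

theorem tendsto_shift {n : ℕ} (z : ℕ → Fin n → ℝ) (zs : Fin n → ℝ) (φ : ℕ → ℕ)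
    (hφ : StrictMono φ) (hz : Filter.Tendsto (fun j => z (φ j)) Filter.atTop (nhds zs)) :
    Filter.Tendsto (fun j => z (φ j - 1 + 1)) Filter.atTop (nhds zs) := by
  refine hz.congr' ?_
  filter_upwards [hφ.tendsto_atTop.eventually_ge_atTop 1] with j hj
  rw [Nat.sub_add_cancel hj]

theorem tendsto_shift' {n : ℕ} (z : ℕ → Fin n → ℝ) (zs : Fin n → ℝ) (φ : ℕ → ℕ)
    (hφ : StrictMono φ) (hz : Filter.Tendsto (fun j => z (φ j)) Filter.atTop (nhds zs))
    (hd : Filter.Tendsto (fun k => z (k + 1) - z k) Filter.atTop (nhds 0)) :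
    Filter.Tendsto (fun j => z (φ j - 1)) Filter.atTop (nhds zs) := by
  have h1 := tendsto_shift z zs φ hφ hz
  have h2 := hd.comp ((Filter.tendsto_sub_atTop_nat 1).comp hφ.tendsto_atTop)
  have h3 := h1.sub h2
  simpa [Function.comp_def] using h3

open Matrix Filter Set in
/-- Stationary points of ADMM for the unconstrained lifted ℓ1 problem with `U = [0,∞)^n` and a
Type C lifting function `g(u) = Σ g_i(u_i)` continuously differentiable on `U`: if
`ρ ≥ √2 γ C_A` and `(u^k, x^k)` is bounded, then `(y^k, v^k)` is bounded and every limit point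
`(u*, x*, y*, v*)` satisfies `x* = y*`, `v* = ∇ψ(y*) = γAᵀ(Ay* - b)`, and the stationarity
conditions `0 = |x*| + α ∇g(u*) - s*` and `0 = u* ⊙ p* + ∇ψ(x*)` for some `s* ≥ 0` with
`s* ⊙ u* = 0` and some `p*` with `p*_i ∈ [-1,1]` and `p*_i = sign(x*_i)` when `x*_i ≠ 0`. -/
theorem admm_stationary_points {m n : ℕ}
    (A : Matrix (Fin m) (Fin n) ℝ) (b : Fin m → ℝ)
    (g : Fin n → ℝ → ℝ) (a c : ℝ)
    (hconv : ∀ i, ConvexOn ℝ (Set.Ici 0) (g i))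
    (hC1 : ∀ i, ContDiffOn ℝ 1 (g i) (Set.Ici 0))
    (hval0 : ∀ i, g i 0 = a) (hcb : c < a)
    (hmin : ∀ i, (∃ d : ℝ, d ≠ 0 ∧ 0 ≤ d ∧ g i d = c) ∧ ∀ t ∈ Set.Ici (0 : ℝ), c ≤ g i t)
    (α γ ρ : ℝ) (hα : 0 < α) (hγ : 0 < γ) (hρ : 0 < ρ)
    (u x y v : ℕ → Fin n → ℝ)
    (huU : ∀ k : ℕ, ∀ i, 0 ≤ u (k + 1) i)
    (huupd : ∀ k : ℕ, ∀ w : Fin n → ℝ, (∀ i, 0 ≤ w i) →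
      (∑ i, u (k + 1) i * |x k i|) + α * ∑ i, g i (u (k + 1) i) ≤
        (∑ i, w i * |x k i|) + α * ∑ i, g i (w i))
    (hxupd : ∀ k : ℕ, ∀ z : Fin n → ℝ,
      augLag A b (fun w => ∑ i, g i (w i)) α γ ρ (u (k + 1)) (x (k + 1)) (y k) (v k) ≤
        augLag A b (fun w => ∑ i, g i (w i)) α γ ρ (u (k + 1)) z (y k) (v k))
    (hyupd : ∀ k : ℕ, ∀ z : Fin n → ℝ,
      augLag A b (fun w => ∑ i, g i (w i)) α γ ρ (u (k + 1)) (x (k + 1)) (y (k + 1)) (v k) ≤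
        augLag A b (fun w => ∑ i, g i (w i)) α γ ρ (u (k + 1)) (x (k + 1)) z (v k))
    (hvupd : ∀ k : ℕ, v (k + 1) = v k + ρ • (x (k + 1) - y (k + 1)))
    (hρbig : Real.sqrt 2 * γ * specNorm (Aᵀ * A) ≤ ρ)
    (hbounded : ∃ M : ℝ, ∀ k : ℕ, l2norm (u k) ≤ M ∧ l2norm (x k) ≤ M) :
    (∃ M : ℝ, ∀ k : ℕ, l2norm (y k) ≤ M ∧ l2norm (v k) ≤ M) ∧
    ∀ (ustar xstar ystar vstar : Fin n → ℝ) (φ : ℕ → ℕ), StrictMono φ →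
      Tendsto (fun j => u (φ j)) atTop (nhds ustar) →
      Tendsto (fun j => x (φ j)) atTop (nhds xstar) →
      Tendsto (fun j => y (φ j)) atTop (nhds ystar) →
      Tendsto (fun j => v (φ j)) atTop (nhds vstar) →
      xstar = ystar ∧
      vstar = γ • Aᵀ.mulVec (A.mulVec ystar - b) ∧
      ∃ sstar pstar : Fin n → ℝ,
        (∀ i, 0 ≤ sstar i) ∧ (∀ i, sstar i * ustar i = 0) ∧
        (∀ i, pstar i ∈ Set.Icc (-1 : ℝ) 1) ∧
        (∀ i, xstar i ≠ 0 → pstar i = Real.sign (xstar i)) ∧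
        (∀ i, (0 : ℝ) = |xstar i| + α * derivWithin (g i) (Set.Ici 0) (ustar i) - sstar i) ∧
        (∀ i, (0 : ℝ) = ustar i * pstar i + γ * (Aᵀ.mulVec (A.mulVec xstar - b)) i) := by
  obtain ⟨M, hM⟩ := hbounded
  have hM0 : 0 ≤ M := (l2norm_nonneg _).trans (hM 0).1
  have hxb : ∀ k, l2sq (x k) ≤ M ^ 2 := fun k => by
    rw [← l2norm_sq]; exact pow_le_pow_left₀ (l2norm_nonneg _) (hM k).2 2
  set G : (Fin n → ℝ) → ℝ := fun w => ∑ i, g i (w i) with hG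
  have hgrad : ∀ k, γ • Aᵀ.mulVec (A.mulVec (y (k + 1)) - b) - v k
      - ρ • (x (k + 1) - y (k + 1)) = 0 := fun k => aug_y_opt _ _ _ _ _ _ _ _ _ _ (hyupd k)
  have hv : ∀ k, v (k + 1) = γ • Aᵀ.mulVec (A.mulVec (y (k + 1)) - b) := by
    intro k
    rw [hvupd k, eq_comm, ← sub_eq_zero, ← sub_sub]
    exact hgrad k
  obtain ⟨K, hK, hKb⟩ := mulVec_bound A
  obtain ⟨K', hK', hKb'⟩ := mulVec_bound Aᵀ
  have hystep : ∀ k, γ * l2sq (A.mulVec (y (k + 2))) + ρ * l2sq (y (k + 2)) ≤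
      γ * l2sq (A.mulVec (y (k + 1))) + ρ * M ^ 2 := by
    intro k
    have := y_step A b γ ρ hγ hρ (y (k + 1)) (y (k + 2)) (x (k + 2)) (by
      rw [← hv k, ← hv (k + 1)]; exact hvupd (k + 1))
    have h2 := mul_le_mul_of_nonneg_left (hxb (k + 2)) hρ.le
    linarith
  obtain ⟨B, hB⟩ : ∃ B, ∀ k, γ * l2sq (A.mulVec (y (k + 1))) ≤ B := by
    refine ⟨max (γ * l2sq (A.mulVec (y 1))) (γ * K * M ^ 2), fun k => ?_⟩
    induction k with
    | zero => exact le_max_left _ _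
    | succ k ih =>
      set B := max (γ * l2sq (A.mulVec (y 1))) (γ * K * M ^ 2)
      have hB2 : γ * K * M ^ 2 ≤ B := le_max_right _ _
      have h1 := hystep k
      have h2 := hKb (y (k + 2))
      set E := l2sq (A.mulVec (y (k + 2)))
      have hgk : 0 < γ * K := by positivity
      have h3 : ρ * E ≤ K * (ρ * l2sq (y (k + 2))) := by nlinarith
      have h4 : γ * K * (γ * E) + ρ * (γ * E) ≤ γ * K * B + ρ * B := by
        have h5 : γ * (ρ * E) ≤ γ * (K * (B + ρ * M ^ 2 - γ * E)) := by
          apply mul_le_mul_of_nonneg_left _ hγ.le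
          refine h3.trans (mul_le_mul_of_nonneg_left ?_ hK.le)
          linarith
        have h6 := mul_le_mul_of_nonneg_left hB2 hρ.le
        linarith
      by_contra hcon
      push Not at hcon
      have hcon' : B < γ * E := hcon
      nlinarith [mul_pos (add_pos hgk hρ) (sub_pos.mpr hcon')]
  obtain ⟨By, hBy⟩ : ∃ By, ∀ k, l2sq (y k) ≤ By := by
    obtain ⟨B1, hB1⟩ := bdd_shift (fun k => l2sq (y (k + 1))) ((B + ρ * M ^ 2) / ρ) (fun k => by
      show l2sq (y (k + 2)) ≤ _
      rw [le_div_iff₀ hρ]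
      have h1 := hystep k
      have h2 := hB k
      have h3 := mul_nonneg hγ.le (l2sq_nonneg (A.mulVec (y (k + 2))))
      linarith)
    exact bdd_shift (fun k => l2sq (y k)) B1 hB1
  obtain ⟨Bv, hBv⟩ : ∃ Bv, ∀ k, l2sq (v k) ≤ Bv := by
    refine bdd_shift (fun k => l2sq (v k)) (γ ^ 2 * (K' * (2 * (K * By) + 2 * l2sq b)))
      (fun k => ?_)
    rw [hv k, l2sq_smul]
    apply mul_le_mul_of_nonneg_left _ (sq_nonneg γ)
    refine (hKb' _).trans (mul_le_mul_of_nonneg_left ?_ hK'.le)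
    have h1 := l2sq_sub_le (A.mulVec (y (k + 1))) b
    have h2 := hKb (y (k + 1))
    have h3 := mul_le_mul_of_nonneg_left (hBy (k + 1)) hK.le
    linarith
  have hdv : ∀ k, v (k + 2) - v (k + 1) =
      γ • Aᵀ.mulVec (A.mulVec (y (k + 2) - y (k + 1))) := by
    intro k
    rw [hv (k + 1), hv k, ← smul_sub, ← Matrix.mulVec_sub, Matrix.mulVec_sub A]
    congr 2
    abel
  have hdvx : ∀ k, v (k + 1) - v k = ρ • (x (k + 1) - y (k + 1)) := by
    intro k; rw [hvupd k]; abel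
  refine ⟨⟨max (Real.sqrt By) (Real.sqrt Bv), fun k =>
    ⟨(Real.sqrt_le_sqrt (hBy k)).trans (le_max_left _ _),
      (Real.sqrt_le_sqrt (hBv k)).trans (le_max_right _ _)⟩⟩, ?_⟩
  -- coordinatewise x optimality
  have hxc : ∀ k i t, qx ρ (u (k + 1) i) (v k i) (y k i) (x (k + 1) i) ≤
      qx ρ (u (k + 1) i) (v k i) (y k i) t := by
    intro k i t
    refine sum_min_coord (fun i s => qx ρ (u (k + 1) i) (v k i) (y k i) s) Set.univ
      (x (k + 1)) (fun _ => Set.mem_univ _) (fun z _ => ?_) i t (Set.mem_univ _)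
    have := hxupd k z
    rw [aug_x_sum, aug_x_sum] at this
    linarith
  have huc : ∀ k i t, 0 ≤ t → u (k + 1) i * |x k i| + α * g i (u (k + 1) i) ≤
      t * |x k i| + α * g i t := by
    intro k i t ht
    refine sum_min_coord (fun i s => s * |x k i| + α * g i s) (Set.Ici 0)
      (u (k + 1)) (fun i => huU k i) (fun z hz => ?_) i t ht
    have := huupd k z hz
    simp only [Finset.sum_add_distrib, ← Finset.mul_sum]
    exact this
  -- descent
  set L : ℕ → ℝ := fun k => augLag A b G α γ ρ (u (k + 1)) (x (k + 1)) (y (k + 1)) (v (k + 1))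
    with hL
  set D : ℕ → ℝ := fun k => ρ / 2 * l2sq (x (k + 2) - x (k + 1)) +
    γ / 2 * l2sq (A.mulVec (y (k + 2) - y (k + 1))) with hD
  have hdesc : ∀ k, L (k + 1) + D k ≤ L k := by
    intro k
    have s1 : augLag A b G α γ ρ (u (k + 2)) (x (k + 1)) (y (k + 1)) (v (k + 1)) ≤ L k := by
      have := huupd (k + 1) (u (k + 1)) (huU k)
      simp only [hL, augLag, hG]
      linarith
    have s2 : augLag A b G α γ ρ (u (k + 2)) (x (k + 2)) (y (k + 1)) (v (k + 1)) +
        ρ / 2 * l2sq (x (k + 2) - x (k + 1)) ≤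
        augLag A b G α γ ρ (u (k + 2)) (x (k + 1)) (y (k + 1)) (v (k + 1)) := by
      rw [aug_x_sum, aug_x_sum, add_assoc]
      apply add_le_add_right
      simp only [l2sq, Finset.mul_sum, ← Finset.sum_add_distrib, Pi.sub_apply]
      apply Finset.sum_le_sum
      intro i _
      have := qx_strong ρ _ _ _ _ (x (k + 1) i) (huU (k + 1) i) (hxc (k + 1) i)
      have e : (x (k + 2) i - x (k + 1) i) ^ 2 = (x (k + 1) i - x (k + 1 + 1) i) ^ 2 := by ring
      rw [e]
      exact this
    have s3 : augLag A b G α γ ρ (u (k + 2)) (x (k + 2)) (y (k + 1)) (v (k + 1)) =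
        augLag A b G α γ ρ (u (k + 2)) (x (k + 2)) (y (k + 2)) (v (k + 1)) +
        (γ / 2 * l2sq (A.mulVec (y (k + 2) - y (k + 1))) +
          ρ / 2 * l2sq (y (k + 2) - y (k + 1))) := by
      have := aug_y_expand A b G α γ ρ (u (k + 2)) (x (k + 2)) (y (k + 2)) (v (k + 1))
        (-(y (k + 2) - y (k + 1)))
      rw [hgrad (k + 1), zero_dotProduct, add_zero, Matrix.mulVec_neg, l2sq_neg, l2sq_neg] at this
      rw [← this]
      congr 1
      abel
    have s4 : L (k + 1) = augLag A b G α γ ρ (u (k + 2)) (x (k + 2)) (y (k + 2)) (v (k + 1)) +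
        ρ * l2sq (x (k + 2) - y (k + 2)) := by
      have e : ∑ i, v (k + 2) i * (x (k + 2) i - y (k + 2) i) =
          ∑ i, v (k + 1) i * (x (k + 2) i - y (k + 2) i) +
            ρ * l2sq (x (k + 2) - y (k + 2)) := by
        rw [hvupd (k + 1), l2sq, Finset.mul_sum, ← Finset.sum_add_distrib]
        apply Finset.sum_congr rfl
        intro i _
        simp only [Pi.add_apply, Pi.smul_apply, Pi.sub_apply, smul_eq_mul]
        ring
      simp only [hL, augLag]
      rw [e]
      ring
    have s5 : ρ * l2sq (x (k + 2) - y (k + 2)) ≤ ρ / 2 * l2sq (y (k + 2) - y (k + 1)) := by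
      have e1 := hdvx (k + 1)
      rw [hdv k] at e1
      have e2 := congrArg l2sq e1
      rw [l2sq_smul, l2sq_smul, Matrix.mulVec_mulVec] at e2
      have h1 := specNorm_bound (Aᵀ * A) (y (k + 2) - y (k + 1))
      have h2 := pow_le_pow_left₀ (l2norm_nonneg _) h1 2
      rw [mul_pow, l2norm_sq, l2norm_sq] at h2
      have h3 := pow_le_pow_left₀ (by
        have := specNorm_nonneg (Aᵀ * A); positivity) hρbig 2
      rw [mul_pow, mul_pow, Real.sq_sqrt (by norm_num)] at h3
      have h4 := l2sq_nonneg (y (k + 2) - y (k + 1))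
      have h5 := mul_le_mul_of_nonneg_left h2 (sq_nonneg γ)
      have h6 := mul_le_mul_of_nonneg_right h3 h4
      have h7 : ρ * (ρ * l2sq (x (k + 2) - y (k + 2))) ≤
          ρ * (ρ / 2 * l2sq (y (k + 2) - y (k + 1))) := by
        have e2' : γ ^ 2 * l2sq ((Aᵀ * A).mulVec (y (k + 2) - y (k + 1))) =
          ρ ^ 2 * l2sq (x (k + 2) - y (k + 2)) := e2
        nlinarith
      exact le_of_mul_le_mul_left h7 hρ
    simp only [hD]
    linarith
  have hDnn : ∀ k, 0 ≤ D k := fun k => by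
    have := l2sq_nonneg (x (k + 2) - x (k + 1))
    have := l2sq_nonneg (A.mulVec (y (k + 2) - y (k + 1)))
    simp only [hD]
    positivity
  have hLb : ∀ k, α * (∑ _i : Fin n, c) - (Bv + (2 * M ^ 2 + 2 * By)) / 2 ≤ L k := by
    intro k
    have h1 : 0 ≤ ∑ i, u (k + 1) i * |x (k + 1) i| :=
      Finset.sum_nonneg fun i _ => mul_nonneg (huU k i) (abs_nonneg _)
    have h2 : α * (∑ _i : Fin n, c) ≤ α * G (u (k + 1)) :=
      mul_le_mul_of_nonneg_left (Finset.sum_le_sum fun i _ => (hmin i).2 _ (huU k i)) hα.le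
    have h3 : 0 ≤ γ / 2 * l2sq (A.mulVec (y (k + 1)) - b) :=
      mul_nonneg (by positivity) (l2sq_nonneg _)
    have h4 : 0 ≤ ρ / 2 * l2sq (x (k + 1) - y (k + 1)) :=
      mul_nonneg (by positivity) (l2sq_nonneg _)
    have h5 := dot_le (-(v (k + 1))) (x (k + 1) - y (k + 1))
    rw [neg_dotProduct, l2sq_neg] at h5
    have h6 := l2sq_sub_le (x (k + 1)) (y (k + 1))
    have h7 := hxb (k + 1)
    have h8 := hBy (k + 1)
    have h9 := hBv (k + 1)
    have h10 : ∑ i, v (k + 1) i * (x (k + 1) i - y (k + 1) i) =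
      v (k + 1) ⬝ᵥ (x (k + 1) - y (k + 1)) := rfl
    simp only [hL, augLag]
    rw [h10]
    linarith
  have hD0 := tendsto_descent L D hDnn hdesc _ hLb
  have tdx : Tendsto (fun k => x (k + 1) - x k) atTop (nhds 0) := by
    rw [← tendsto_add_atTop_iff_nat 1]
    apply tendsto_of_l2sq
    refine squeeze_zero (fun j => l2sq_nonneg _) (fun j => ?_)
      (by simpa using hD0.const_mul (2 / ρ))
    have h1 : 0 ≤ γ / 2 * l2sq (A.mulVec (y (j + 2) - y (j + 1))) :=
      mul_nonneg (by positivity) (l2sq_nonneg _)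
    have h2 : ρ / 2 * l2sq (x (j + 2) - x (j + 1)) ≤ D j := by simp only [hD]; linarith
    rw [div_mul_eq_mul_div, le_div_iff₀ hρ]
    have h3 : l2sq (x (j + 1 + 1) - x (j + 1)) = l2sq (x (j + 2) - x (j + 1)) := rfl
    linarith
  have tAdy : Tendsto (fun k => A.mulVec (y (k + 2) - y (k + 1))) atTop (nhds 0) := by
    apply tendsto_of_l2sq
    refine squeeze_zero (fun j => l2sq_nonneg _) (fun j => ?_)
      (by simpa using hD0.const_mul (2 / γ))
    have h1 : 0 ≤ ρ / 2 * l2sq (x (j + 2) - x (j + 1)) :=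
      mul_nonneg (by positivity) (l2sq_nonneg _)
    have h2 : γ / 2 * l2sq (A.mulVec (y (j + 2) - y (j + 1))) ≤ D j := by
      simp only [hD]; linarith
    rw [div_mul_eq_mul_div, le_div_iff₀ hγ]
    linarith
  have tdv : Tendsto (fun k => v (k + 1) - v k) atTop (nhds 0) := by
    rw [← tendsto_add_atTop_iff_nat 1]
    have hc : Continuous fun z : Fin m → ℝ => γ • Aᵀ.mulVec z := by fun_prop
    have h1 := (hc.tendsto 0).comp tAdy
    rw [Matrix.mulVec_zero, smul_zero] at h1
    exact h1.congr fun k => (hdv k).symm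
  have txy : Tendsto (fun k => x k - y k) atTop (nhds 0) := by
    rw [← tendsto_add_atTop_iff_nat 1]
    have h1 := tdv.const_smul ρ⁻¹
    rw [smul_zero] at h1
    refine h1.congr fun k => ?_
    rw [hdvx k, smul_smul, inv_mul_cancel₀ hρ.ne', one_smul]
  have tdy : Tendsto (fun k => y (k + 1) - y k) atTop (nhds 0) := by
    have h1 := (tdx.sub ((tendsto_add_atTop_iff_nat 1).mpr txy)).add txy
    rw [sub_zero, add_zero] at h1
    refine h1.congr fun k => ?_
    abel
  intro us xs ys vs φ hφ hu hx hy hvv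
  have hxy : xs = ys := by
    have h1 := txy.comp hφ.tendsto_atTop
    exact sub_eq_zero.mp (tendsto_nhds_unique (hx.sub hy) h1)
  have hvs : vs = γ • Aᵀ.mulVec (A.mulVec ys - b) := by
    have hc : Continuous fun z : Fin n → ℝ => γ • Aᵀ.mulVec (A.mulVec z - b) := by fun_prop
    refine tendsto_nhds_unique (tendsto_shift v vs φ hφ hvv) ?_
    refine ((hc.tendsto ys).comp (tendsto_shift y ys φ hφ hy)).congr fun j => ?_
    exact (hv _).symm
  have hu1 := tendsto_pi_nhds.mp (tendsto_shift u us φ hφ hu)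
  have hx1 := tendsto_pi_nhds.mp (tendsto_shift x xs φ hφ hx)
  have hx0 := tendsto_pi_nhds.mp (tendsto_shift' x xs φ hφ hx tdx)
  have hy0 := tendsto_pi_nhds.mp (tendsto_shift' y ys φ hφ hy tdy)
  have hv0 := tendsto_pi_nhds.mp (tendsto_shift' v vs φ hφ hvv tdv)
  have hus : ∀ i, 0 ≤ us i := fun i => ge_of_tendsto' (hu1 i) fun j => huU _ i
  have hust : ∀ i, 0 ≤ |xs i| + α * derivWithin (g i) (Set.Ici 0) (us i) ∧
      (|xs i| + α * derivWithin (g i) (Set.Ici 0) (us i)) * us i = 0 := by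
    intro i
    refine u_stat (g i) (hC1 i) |xs i| α (us i) (hus i) fun t ht => ?_
    have hg : Tendsto (fun j => g i (u (φ j - 1 + 1) i)) atTop (nhds (g i (us i))) := by
      have h1 := (hC1 i).continuousOn (us i) (hus i)
      exact h1.tendsto.comp (tendsto_nhdsWithin_iff.mpr
        ⟨hu1 i, Eventually.of_forall fun j => huU _ i⟩)
    exact le_of_tendsto_of_tendsto' (((hu1 i).mul (hx0 i).abs).add (hg.const_mul α))
      (((hx0 i).abs.const_mul t).add_const (α * g i t)) fun j => huc (φ j - 1) i t ht
  have hxst : ∀ i, ∃ p : ℝ, p ∈ Set.Icc (-1 : ℝ) 1 ∧ (xs i ≠ 0 → p = Real.sign (xs i)) ∧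
      0 = us i * p + vs i := by
    intro i
    refine x_stat ρ (us i) (vs i) (xs i) (hus i) fun t => ?_
    have hy0' := hy0 i
    rw [← hxy] at hy0'
    refine le_of_tendsto_of_tendsto' (b := atTop)
      (f := fun j => qx ρ (u (φ j - 1 + 1) i) (v (φ j - 1) i) (y (φ j - 1) i) (x (φ j - 1 + 1) i))
      (g := fun j => qx ρ (u (φ j - 1 + 1) i) (v (φ j - 1) i) (y (φ j - 1) i) t)
      ?_ ?_ fun j => hxc (φ j - 1) i t
    · exact (((hu1 i).mul (hx1 i).abs).add ((hv0 i).mul ((hx1 i).sub hy0'))).add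
        ((((hx1 i).sub hy0').pow 2).const_mul (ρ / 2))
    · exact (((hu1 i).mul_const _).add ((hv0 i).mul (hy0'.const_sub t))).add
        (((hy0'.const_sub t).pow 2).const_mul (ρ / 2))
  choose p hp1 hp2 hp3 using hxst
  refine ⟨hxy, hvs, fun i => |xs i| + α * derivWithin (g i) (Set.Ici 0) (us i), p,
    fun i => (hust i).1, fun i => (hust i).2, hp1, hp2, fun i => by simp, fun i => ?_⟩
  have := hp3 i
  rw [hvs, ← hxy] at this
  simpa using this
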